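/- Let D = (P, B, I) be a 2-(v,k,λ) design and let B₁ ⊆ B be a switching set of D with associated point sets P₁, P₂ ⊆ P. Then in the incidence structure D₁ = (P, B, I₁) obtained from D by switching with respect to B₁, any two distinct points Q₁, Q₂ ∈ P \ (P₁ ∪ P₂) are together incident with exactly λ blocks. -/

import Mathlib

open Finset
open scoped Classical

/-- `I p b` means point `p` is incident with block `b`.  `IsDesign I v k lam` says the
incidence structure on point type `α` and block type `β` is a 2-(v,k,λ) design. -/
def IsDesign {α β : Type*} [Fintype α] [Fintype β] (I : α → β → Prop)
    (v k lam : ℕ) : Prop :=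
  Fintype.card α = v ∧ 1 < k ∧ k < v - 1 ∧
  (∀ b : β, (Finset.univ.filter fun p : α => I p b).card = k) ∧
  ∀ p q : α, p ≠ q → (Finset.univ.filter fun b : β => I p b ∧ I q b).card = lam

/-- `B₁` is a switching set with associated point sets `P₁`, `P₂`. -/
def IsSwitchingSet {α β : Type*} (I : α → β → Prop) (B₁ : Finset β)
    (P₁ P₂ : Finset α) : Prop :=
  (∀ p ∈ P₁, ∀ b ∈ B₁, ¬ I p b) ∧
  (∀ p ∈ P₂, ∀ b ∈ B₁, I p b) ∧
  ∀ p : α, p ∉ P₁ → p ∉ P₂ →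
    (B₁.filter fun b => I p b).card = (B₁.filter fun b => ¬ I p b).card

/-- The incidence relation obtained by switching with respect to `B₁`. -/
def switchInc {α β : Type*} (I : α → β → Prop) (B₁ : Finset β)
    (P₁ P₂ : Finset α) : α → β → Prop :=
  fun p b => if b ∈ B₁ ∧ p ∉ P₁ ∧ p ∉ P₂ then ¬ I p b else I p b

/-- After switching, two distinct points outside P₁ ∪ P₂ are together incident with
exactly lam blocks. -/
theorem switching_pair_count {α β : Type*} [Fintype α] [Fintype β]
    (I : α → β → Prop) (v k lam : ℕ) (B₁ : Finset β) (P₁ P₂ : Finset α)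
    (hD : IsDesign I v k lam) (hS : IsSwitchingSet I B₁ P₁ P₂)
    (Q₁ Q₂ : α) (hQ : Q₁ ≠ Q₂) (hQ₁ : Q₁ ∉ P₁ ∪ P₂) (hQ₂ : Q₂ ∉ P₁ ∪ P₂) :
    (Finset.univ.filter fun b : β =>
      switchInc I B₁ P₁ P₂ Q₁ b ∧ switchInc I B₁ P₁ P₂ Q₂ b).card = lam := by
  obtain ⟨-, -, -, -, hl⟩ := hD
  obtain ⟨-, -, hh⟩ := hS
  simp only [Finset.mem_union, not_or] at hQ₁ hQ₂
  have h1 := hh Q₁ hQ₁.1 hQ₁.2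
  have h2 := hh Q₂ hQ₂.1 hQ₂.2
  rw [← hl Q₁ Q₂ hQ]
  zify at h1 h2 ⊢
  simp only [Finset.card_filter, Nat.cast_sum] at h1 h2 ⊢
  rw [← sub_eq_zero, ← Finset.sum_sub_distrib] at h1 h2 ⊢
  have key : ∀ b : β,
      (((if switchInc I B₁ P₁ P₂ Q₁ b ∧ switchInc I B₁ P₁ P₂ Q₂ b then 1 else 0 : ℕ) : ℤ)
        - ((if I Q₁ b ∧ I Q₂ b then 1 else 0 : ℕ) : ℤ)) * 2 =
      if b ∈ B₁ then
        -((((if I Q₁ b then 1 else 0 : ℕ) : ℤ) - ((if ¬ I Q₁ b then 1 else 0 : ℕ) : ℤ))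
          + (((if I Q₂ b then 1 else 0 : ℕ) : ℤ) - ((if ¬ I Q₂ b then 1 else 0 : ℕ) : ℤ)))
      else 0 := by
    intro b
    by_cases hb : b ∈ B₁ <;> by_cases a1 : I Q₁ b <;> by_cases a2 : I Q₂ b <;>
      simp [switchInc, hb, a1, a2, hQ₁, hQ₂]
  have hs := Finset.sum_congr (rfl : (Finset.univ : Finset β) = Finset.univ) fun b _ => key b
  rw [← Finset.sum_mul, Finset.sum_ite_mem, Finset.univ_inter, Finset.sum_neg_distrib,
    Finset.sum_add_distrib, h1, h2] at hs
  linarith
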